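/- arXiv:2508.10162 — 6 statements merged into one kernel-verified Lean document; each statement's English description precedes it below -/
import Mathlib

section
/- Let C be a finite connected category. The following are equivalent: (i) every indecomposable C-set is simple (C is semisimple); (ii) there are only finitely many indecomposable C-sets up to isomorphism (C is of finite type); (iii) every morphism of C is an isomorphism (C is a groupoid); (iv) for every C-set Ω, all objects x, y of C and all a ∈ Ω(x), b ∈ Ω(y), if (x,a) and (y,b) are connected by a zigzag in the category of elements of Ω, then there exists a morphism f : x ⟶ y with Ω(f)(a) = b. -/
open CategoryTheory

universe v u

section Defs

variable {C : Type u} [Category.{v} C]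

/-- `S` is a subfunctor of the `C`-set `Ω`: a family of subsets `S x ⊆ Ω(x)` such that
`Ω(f)(S x) ⊆ S y` for every morphism `f : x ⟶ y`. -/
def IsSubfunctor (Ω : C ⥤ FintypeCat) (S : ∀ x : C, Set (Ω.obj x)) : Prop :=
  ∀ ⦃x y : C⦄ (f : x ⟶ y), ∀ a ∈ S x, Ω.map f a ∈ S y

/-- A `C`-set is nonempty if it has a nonempty value at some object. -/
def CSetNonempty (Ω : C ⥤ FintypeCat) : Prop :=
  ∃ x : C, Nonempty (Ω.obj x)

/-- A `C`-set is indecomposable if it is nonempty and whenever two subfunctors are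
pointwise disjoint with pointwise union all of `Ω`, one of them is pointwise empty. -/
def Indecomposable (Ω : C ⥤ FintypeCat) : Prop :=
  CSetNonempty Ω ∧
    ∀ S T : ∀ x : C, Set (Ω.obj x), IsSubfunctor Ω S → IsSubfunctor Ω T →
      (∀ x, S x ∩ T x = ∅) → (∀ x, S x ∪ T x = Set.univ) →
      (∀ x, S x = ∅) ∨ (∀ x, T x = ∅)

/-- A `C`-set is simple if it is nonempty and its only subfunctors are the pointwise
empty one and the whole functor. -/
def SimpleCSet (Ω : C ⥤ FintypeCat) : Prop :=
  CSetNonempty Ω ∧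
    ∀ S : ∀ x : C, Set (Ω.obj x), IsSubfunctor Ω S →
      (∀ x, S x = ∅) ∨ (∀ x, S x = Set.univ)

/-- One step of a zigzag in the category of elements of `Ω`: a morphism of `C` carrying
one element to the other, in one direction or the other. -/
def ElemStep (Ω : C ⥤ FintypeCat) : (Σ x : C, Ω.obj x) → (Σ x : C, Ω.obj x) → Prop :=
  fun p q => (∃ f : p.1 ⟶ q.1, Ω.map f p.2 = q.2) ∨ ∃ f : q.1 ⟶ p.1, Ω.map f q.2 = p.2

/-- Two elements of a `C`-set are connected by a walk, i.e. by a zigzag in the category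
of elements of `Ω`. -/
def WalkConnected (Ω : C ⥤ FintypeCat) (p q : Σ x : C, Ω.obj x) : Prop :=
  Relation.ReflTransGen (ElemStep Ω) p q

end Defs

namespace FinCSet

variable {C : Type u} [Category.{v} C]

theorem WalkConnected.symm {Ω : C ⥤ FintypeCat} {p q : Σ x : C, Ω.obj x}
    (h : WalkConnected Ω p q) : WalkConnected Ω q p :=
  haveI : Std.Symm (ElemStep Ω) := ⟨fun _ _ h => Or.symm h⟩
  Relation.ReflTransGen.stdSymm.symm _ _ h

theorem WalkConnected.mem_of_isSubfunctor {Ω : C ⥤ FintypeCat} {S T : ∀ x : C, Set (Ω.obj x)}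
    (hS : IsSubfunctor Ω S) (hT : IsSubfunctor Ω T) (hST : ∀ x, S x ∩ T x = ∅)
    (hun : ∀ x, S x ∪ T x = Set.univ) {p q : Σ x : C, Ω.obj x} (h : WalkConnected Ω p q)
    (hp : p.2 ∈ S p.1) : q.2 ∈ S q.1 := by
  induction h with
  | refl => exact hp
  | tail _ hstep ih =>
    rename_i b c _
    rcases hstep with ⟨f, hf⟩ | ⟨f, hf⟩
    · exact hf ▸ hS f _ ih
    · by_contra hc
      have hcT : c.2 ∈ T c.1 := by
        have : c.2 ∈ S c.1 ∪ T c.1 := by rw [hun]; trivial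
        exact this.resolve_left hc
      have : b.2 ∈ S b.1 ∩ T b.1 := ⟨ih, hf ▸ hT f _ hcT⟩
      rw [hST] at this
      exact this

/-- A `C`-set is indecomposable iff it is nonempty and its category of elements has a single
zigzag class. -/
theorem indecomposable_iff_walkConnected {Ω : C ⥤ FintypeCat} :
    Indecomposable Ω ↔ CSetNonempty Ω ∧ ∀ p q, WalkConnected Ω p q := by
  refine ⟨fun h => ⟨h.1, fun p q => ?_⟩, fun h => ⟨h.1, fun S T hS hT hST hun => ?_⟩⟩
  · have key := h.2 (fun x => {a | WalkConnected Ω p ⟨x, a⟩})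
      (fun x => {a | ¬ WalkConnected Ω p ⟨x, a⟩})
      (fun x y f a ha => ha.tail (Or.inl ⟨f, rfl⟩))
      (fun x y f a ha hb => ha (hb.tail (Or.inr ⟨f, rfl⟩)))
      (fun x => Set.inter_compl_self _) (fun x => Set.union_compl_self _)
    rcases key with h | h
    · have : p.2 ∈ (∅ : Set (Ω.obj p.1)) := h p.1 ▸ Relation.ReflTransGen.refl
      exact this.elim
    · by_contra hq
      have : q.2 ∈ (∅ : Set (Ω.obj q.1)) := h q.1 ▸ hq
      exact this
  · obtain ⟨⟨x, ⟨a⟩⟩, hw⟩ := h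
    have ha : a ∈ S x ∪ T x := by rw [hun]; trivial
    rcases ha with ha | ha
    · refine Or.inr fun y => Set.eq_empty_iff_forall_notMem.2 fun b hb => ?_
      have : b ∈ S y ∩ T y :=
        ⟨WalkConnected.mem_of_isSubfunctor hS hT hST hun (hw ⟨x, a⟩ ⟨y, b⟩) ha, hb⟩
      rw [hST] at this
      exact this
    · refine Or.inl fun y => Set.eq_empty_iff_forall_notMem.2 fun b hb => ?_
      have : a ∈ S x ∩ T x :=
        ⟨WalkConnected.mem_of_isSubfunctor hS hT hST hun (hw ⟨y, b⟩ ⟨x, a⟩) hb, ha⟩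
      rw [hST] at this
      exact this

theorem exists_map_eq_of_walkConnected (hC : ∀ ⦃x y : C⦄ (f : x ⟶ y), IsIso f)
    {Ω : C ⥤ FintypeCat} {p q : Σ x : C, Ω.obj x} (h : WalkConnected Ω p q) :
    ∃ f : p.1 ⟶ q.1, Ω.map f p.2 = q.2 := by
  induction h with
  | refl => exact ⟨𝟙 _, by simp⟩
  | tail _ hstep ih =>
    obtain ⟨g, hg⟩ := ih
    rcases hstep with ⟨f, hf⟩ | ⟨f, hf⟩
    · exact ⟨g ≫ f, by simp [hg, hf]⟩
    · have := hC f
      refine ⟨g ≫ inv f, ?_⟩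
      rw [Ω.map_comp, FintypeCat.comp_apply, hg, ← hf, ← FintypeCat.comp_apply, ← Ω.map_comp]
      simp

theorem Indecomposable.simpleCSet {Ω : C ⥤ FintypeCat} (hΩ : Indecomposable Ω)
    (h : ∀ p q : Σ x : C, Ω.obj x, WalkConnected Ω p q → ∃ f : p.1 ⟶ q.1, Ω.map f p.2 = q.2) :
    SimpleCSet Ω := by
  refine ⟨hΩ.1, fun S hS => or_iff_not_imp_left.2 fun hne y => Set.eq_univ_of_forall fun b => ?_⟩
  simp only [not_forall, ← Set.nonempty_iff_ne_empty] at hne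
  obtain ⟨x, a, ha⟩ := hne
  obtain ⟨f, hf⟩ := h ⟨x, a⟩ ⟨y, b⟩ ((indecomposable_iff_walkConnected.1 hΩ).2 _ _)
  change Ω.map f a = b at hf
  exact hf ▸ hS f a ha

theorem Indecomposable.of_equiv {Ω : C ⥤ FintypeCat} {Ω' : C ⥤ FintypeCat}
    (e : ∀ x, Ω.obj x ≃ Ω'.obj x)
    (he : ∀ ⦃x y : C⦄ (f : x ⟶ y) (a : Ω.obj x), e y (Ω.map f a) = Ω'.map f (e x a))
    (h : Indecomposable Ω) : Indecomposable Ω' := by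
  rw [indecomposable_iff_walkConnected] at h ⊢
  obtain ⟨⟨x, ⟨a⟩⟩, hw⟩ := h
  refine ⟨⟨x, ⟨e x a⟩⟩, fun p q => ?_⟩
  have hstep : ∀ r s, ElemStep Ω r s → ElemStep Ω' ⟨r.1, e r.1 r.2⟩ ⟨s.1, e s.1 s.2⟩ := by
    rintro r s (⟨f, hf⟩ | ⟨f, hf⟩)
    · exact Or.inl ⟨f, by simp [← he, hf]⟩
    · exact Or.inr ⟨f, by simp [← he, hf]⟩
  have := Relation.ReflTransGen.lift _ hstep _ _
    (hw ⟨p.1, (e p.1).symm p.2⟩ ⟨q.1, (e q.1).symm q.2⟩)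
  simpa [WalkConnected, Function.onFun] using this

theorem SimpleCSet.of_equiv {Ω : C ⥤ FintypeCat} {Ω' : C ⥤ FintypeCat}
    (e : ∀ x, Ω.obj x ≃ Ω'.obj x)
    (he : ∀ ⦃x y : C⦄ (f : x ⟶ y) (a : Ω.obj x), e y (Ω.map f a) = Ω'.map f (e x a))
    (h : SimpleCSet Ω') : SimpleCSet Ω := by
  obtain ⟨⟨x, ⟨a⟩⟩, hS⟩ := h
  refine ⟨⟨x, ⟨(e x).symm a⟩⟩, fun S hsub => ?_⟩
  refine (hS (fun x => (e x).symm ⁻¹' S x) fun x y f a ha => ?_).imp (fun h x => ?_) fun h x => ?_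
  · have := he f ((e x).symm a)
    rw [Equiv.apply_symm_apply] at this
    rw [← this]
    simpa using hsub f _ ha
  · exact Set.eq_empty_iff_forall_notMem.2 fun b hb =>
      Set.eq_empty_iff_forall_notMem.1 (h x) (e x b) (by simpa using hb)
  · exact Set.eq_univ_of_forall fun b => by
      simpa using Set.eq_univ_iff_forall.1 (h x) (e x b)

section Glued

variable {x y : C} (f : x ⟶ y) (n : ℕ)

/-- The elements over `z` of the gluing of `n + 1` copies of `Hom(x, -)` along the subfunctor of
morphisms factoring through `f : x ⟶ y`. Elements of the glued part are recorded in the copy with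
index `0`. -/
abbrev GluedElem (z : C) : Type v :=
  {p : (x ⟶ z) × Fin (n + 1) // (∃ g, f ≫ g = p.1) → p.2 = 0}

variable {f n}

open scoped Classical in
/-- The action of a morphism on the elements of the gluing. -/
noncomputable def GluedElem.map {z w : C} (h : z ⟶ w) (p : GluedElem f n z) : GluedElem f n w :=
  ⟨(p.1.1 ≫ h, if ∃ g, f ≫ g = p.1.1 ≫ h then 0 else p.1.2), fun hg => if_pos hg⟩

theorem GluedElem.map_eq {z w : C} {h : z ⟶ w} {p : GluedElem f n z} {q : GluedElem f n w}
    (h₁ : p.1.1 ≫ h = q.1.1) (h₂ : (¬ ∃ g, f ≫ g = q.1.1) → p.1.2 = q.1.2) : p.map h = q := by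
  refine Subtype.ext (Prod.ext h₁ ?_)
  by_cases hg : ∃ g, f ≫ g = q.1.1
  · exact (if_pos (h₁ ▸ hg)).trans (q.2 hg).symm
  · exact (if_neg (h₁ ▸ hg)).trans (h₂ hg)

variable [∀ x y : C, Finite (x ⟶ y)] (f n)

/-- The `C`-set obtained from `n + 1` copies of the representable `Hom(x, -)` by gluing them
along the subfunctor of morphisms factoring through `f : x ⟶ y`. -/
noncomputable def glued : C ⥤ FintypeCat.{v} where
  obj z := .of (GluedElem f n z)
  map h := FintypeCat.homMk (GluedElem.map h)
  map_id z := FintypeCat.hom_ext _ _ fun p =>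
    GluedElem.map_eq (Category.comp_id p.1.1) fun _ => rfl
  map_comp {z w t} h k := FintypeCat.hom_ext _ _ fun p => by
    refine GluedElem.map_eq (Category.assoc p.1.1 h k).symm fun hg =>
      ((if_neg hg).trans (if_neg ?_)).symm
    rintro ⟨g, hg'⟩
    refine hg ⟨g ≫ k, ?_⟩
    rw [← Category.assoc, hg']
    rfl

variable {f}

theorem glued_indecomposable (hf : ¬ ∃ g, f ≫ g = 𝟙 x) : Indecomposable (glued f n) := by
  have base : ∀ p : Σ z : C, (glued f n).obj z,
      WalkConnected (glued f n) p ⟨y, ⟨(f, 0), fun _ => rfl⟩⟩ := by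
    rintro ⟨z, ⟨h, i⟩, hi⟩
    exact Relation.ReflTransGen.trans (b := ⟨x, ⟨(𝟙 x, i), fun hg => (hf hg).elim⟩⟩)
      (.single (.inr ⟨h, GluedElem.map_eq (Category.id_comp h) fun _ => rfl⟩))
      (.single (.inl ⟨f, GluedElem.map_eq (Category.id_comp f) fun hg =>
        (hg ⟨𝟙 y, Category.comp_id f⟩).elim⟩))
  exact indecomposable_iff_walkConnected.2
    ⟨⟨y, ⟨⟨(f, 0), fun _ => rfl⟩⟩⟩, fun p q => (base p).trans (WalkConnected.symm (base q))⟩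

theorem glued_not_simpleCSet (hf : ¬ ∃ g, f ≫ g = 𝟙 x) : ¬ SimpleCSet (glued f n) := by
  intro h
  rcases h.2 (fun z => {p | ∃ g, f ≫ g = p.1.1}) (by
    rintro z w k p ⟨g, hg⟩
    exact ⟨g ≫ k, by rw [← Category.assoc, hg]; rfl⟩) with h | h
  · exact Set.eq_empty_iff_forall_notMem.1 (h y) ⟨(f, 0), fun _ => rfl⟩ ⟨𝟙 _, Category.comp_id _⟩
  · exact hf (Set.eq_univ_iff_forall.1 (h x) ⟨(𝟙 x, 0), fun _ => rfl⟩)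

theorem lt_card_glued (hf : ¬ ∃ g, f ≫ g = 𝟙 x) : n < Nat.card ((glued f n).obj x) := by
  have := Nat.card_le_card_of_injective
    (fun i : Fin (n + 1) => (⟨(𝟙 x, i), fun hg => (hf hg).elim⟩ : (glued f n).obj x))
    (fun i j hij => congrArg (fun p : (glued f n).obj x => p.1.2) hij)
  rwa [Nat.card_fin] at this

end Glued

theorem Indecomposable.comp_uSwitch {Ω : C ⥤ FintypeCat} (h : Indecomposable Ω) :
    Indecomposable (Ω ⋙ FintypeCat.uSwitch) :=
  Indecomposable.of_equiv (fun x => (FintypeCat.uSwitchEquiv (Ω.obj x)).symm)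
    (fun _ _ f a => (FintypeCat.uSwitchEquiv_symm_naturality (Ω.map f) a).symm) h

theorem SimpleCSet.of_comp_uSwitch {Ω : C ⥤ FintypeCat}
    (h : SimpleCSet (Ω ⋙ FintypeCat.uSwitch)) : SimpleCSet Ω :=
  SimpleCSet.of_equiv (fun x => (FintypeCat.uSwitchEquiv (Ω.obj x)).symm)
    (fun _ _ f a => (FintypeCat.uSwitchEquiv_symm_naturality (Ω.map f) a).symm) h

theorem isIso_of_forall_exists_comp_eq_id (h : ∀ ⦃x y : C⦄ (f : x ⟶ y), ∃ g, f ≫ g = 𝟙 x)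
    ⦃x y : C⦄ (f : x ⟶ y) : IsIso f := by
  obtain ⟨g, hg⟩ := h f
  obtain ⟨k, hk⟩ := h g
  have : f = k := by rw [← Category.comp_id f, ← hk, ← Category.assoc, hg, Category.id_comp]
  exact ⟨g, hg, this ▸ hk⟩

theorem isIso_of_semisimple [∀ x y : C, Finite (x ⟶ y)]
    (h : ∀ Ω : C ⥤ FintypeCat, Indecomposable Ω → SimpleCSet Ω) ⦃x y : C⦄ (f : x ⟶ y) :
    IsIso f := by
  refine isIso_of_forall_exists_comp_eq_id (fun x y f => ?_) f
  by_contra hf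
  exact glued_not_simpleCSet 0 hf (SimpleCSet.of_comp_uSwitch
    (h _ (Indecomposable.comp_uSwitch (glued_indecomposable 0 hf))))

theorem isIso_of_finiteType [∀ x y : C, Finite (x ⟶ y)] {n : ℕ} {Ψ : Fin n → C ⥤ FintypeCat}
    (h : ∀ Ω : C ⥤ FintypeCat, Indecomposable Ω → ∃ i, Nonempty (Ω ≅ Ψ i))
    ⦃x y : C⦄ (f : x ⟶ y) : IsIso f := by
  refine isIso_of_forall_exists_comp_eq_id (fun x y f => ?_) f
  by_contra hf
  let N := ∑ i, Nat.card ((Ψ i).obj x)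
  obtain ⟨i, ⟨e⟩⟩ := h _ (Indecomposable.comp_uSwitch (glued_indecomposable N hf))
  have hcard : Nat.card ((glued f N).obj x) = Nat.card ((Ψ i).obj x) :=
    Nat.card_congr ((FintypeCat.uSwitchEquiv _).symm.trans
      (FintypeCat.equivEquivIso.symm (e.app x)))
  have hle : Nat.card ((Ψ i).obj x) ≤ N :=
    Finset.single_le_sum (f := fun i => Nat.card ((Ψ i).obj x)) (fun _ _ => Nat.zero_le _)
      (Finset.mem_univ i)
  exact (lt_card_glued N hf).not_ge (hcard ▸ hle)

/-- Over a category with finitely many morphisms there are, up to isomorphism, only finitely many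
`C`-sets all of whose values have at most `N` elements. -/
theorem exists_finite_representatives [Finite C] [∀ x y : C, Finite (x ⟶ y)] (N : ℕ) :
    ∃ (n : ℕ) (Ψ : Fin n → C ⥤ FintypeCat),
      ∀ Ω : C ⥤ FintypeCat, (∀ x, Nat.card (Ω.obj x) ≤ N) → ∃ i, Nonempty (Ω ≅ Ψ i) := by
  let D := Σ c : C → Fin (N + 1), ∀ x y : C, (x ⟶ y) → Fin (c x) → Fin (c y)
  let R : (C ⥤ FintypeCat) → D → Prop := fun Ω d =>
    ∃ e : ∀ x, Ω.obj x ≃ Fin (d.1 x), ∀ (x y : C) (f : x ⟶ y) (a : Ω.obj x),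
      e y (Ω.map f a) = d.2 x y f (e x a)
  obtain ⟨n, ⟨t⟩⟩ := Finite.exists_equiv_fin {d : D // ∃ Ω, R Ω d}
  refine ⟨n, fun i => (t.symm i).2.choose, fun Ω hΩ => ?_⟩
  let e : ∀ x, Ω.obj x ≃ Fin (Nat.card (Ω.obj x)) := fun x => Finite.equivFin _
  let d : D := ⟨fun x => ⟨Nat.card (Ω.obj x), Nat.lt_succ_of_le (hΩ x)⟩,
    fun x y f a => e y (Ω.map f ((e x).symm a))⟩
  have hd : R Ω d := ⟨e, fun x y f a => by simp [d]⟩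
  refine ⟨t ⟨d, Ω, hd⟩, ?_⟩
  beta_reduce
  rw [Equiv.symm_apply_apply]
  obtain ⟨e₂, h₂⟩ := (⟨Ω, hd⟩ : ∃ Ω, R Ω d).choose_spec
  have ⟨e₁, h₁⟩ := hd
  refine ⟨NatIso.ofComponents
    (fun x => FintypeCat.equivEquivIso ((e₁ x).trans (e₂ x).symm)) fun {x y} f => ?_⟩
  ext a
  apply (e₂ y).injective
  simp [h₁, h₂]

theorem exists_finite_representatives_of_isIso [Finite C] [∀ x y : C, Finite (x ⟶ y)]
    (hC : ∀ ⦃x y : C⦄ (f : x ⟶ y), IsIso f) :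
    ∃ (n : ℕ) (Ψ : Fin n → C ⥤ FintypeCat),
      ∀ Ω : C ⥤ FintypeCat, Indecomposable Ω → ∃ i, Nonempty (Ω ≅ Ψ i) := by
  obtain ⟨n, Ψ, h⟩ := exists_finite_representatives (C := C) (Nat.card (Σ x y : C, x ⟶ y))
  refine ⟨n, Ψ, fun Ω hΩ => h Ω fun y => ?_⟩
  obtain ⟨⟨x, ⟨a⟩⟩, hw⟩ := indecomposable_iff_walkConnected.1 hΩ
  calc Nat.card (Ω.obj y) ≤ Nat.card (x ⟶ y) :=
        Nat.card_le_card_of_surjective (fun f => Ω.map f a) fun b =>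
          exists_map_eq_of_walkConnected hC (hw ⟨x, a⟩ ⟨y, b⟩)
    _ ≤ Nat.card (Σ x y : C, x ⟶ y) :=
        Nat.card_le_card_of_injective (fun f => ⟨x, y, f⟩) fun f g hfg => by simpa using hfg

end FinCSet

/-- For a finite connected category `C`, the following are equivalent: `C` is semisimple
(every indecomposable `C`-set is simple); `C` is of finite type (finitely many
indecomposable `C`-sets up to isomorphism); `C` is a groupoid (every morphism is an
isomorphism); and for every `C`-set, elements connected by a zigzag in the category of
elements are related by the action of a single morphism. -/
theorem groupoid_characterization_tfae {C : Type u} [SmallCategory C] [FinCategory C]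
    [IsConnected C] :
    List.TFAE
      [∀ Ω : C ⥤ FintypeCat, Indecomposable Ω → SimpleCSet Ω,
       ∃ (n : ℕ) (Ψ : Fin n → C ⥤ FintypeCat),
         ∀ Ω : C ⥤ FintypeCat, Indecomposable Ω → ∃ i, Nonempty (Ω ≅ Ψ i),
       ∀ ⦃x y : C⦄ (f : x ⟶ y), IsIso f,
       ∀ (Ω : C ⥤ FintypeCat) (x y : C) (a : Ω.obj x) (b : Ω.obj y),
         WalkConnected Ω ⟨x, a⟩ ⟨y, b⟩ → ∃ f : x ⟶ y, Ω.map f a = b] := by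
  tfae_have 1 → 3 := FinCSet.isIso_of_semisimple
  tfae_have 2 → 3 := fun ⟨_, _, h⟩ => FinCSet.isIso_of_finiteType h
  tfae_have 3 → 1 := fun h _ hΩ =>
    FinCSet.Indecomposable.simpleCSet hΩ fun _ _ => FinCSet.exists_map_eq_of_walkConnected h
  tfae_have 3 → 2 := FinCSet.exists_finite_representatives_of_isIso
  tfae_have 3 → 4 := fun h _ _ _ _ _ => FinCSet.exists_map_eq_of_walkConnected h
  tfae_have 4 → 3 := fun h => FinCSet.isIso_of_semisimple fun Ω hΩ =>
    FinCSet.Indecomposable.simpleCSet hΩ fun _ _ => h Ω _ _ _ _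
  tfae_finish
end

section
/- Let C be a finite category. If every indecomposable C-set is simple, then C is of finite type: there exist finitely many C-sets Ψ₁, …, Ψₙ such that every indecomposable C-set is isomorphic to some Ψᵢ. -/
open CategoryTheory

universe v u

/-- Indecomposability is invariant under natural families of bijections, even between
`C`-sets living in different universes. -/
theorem Indecomposable.of_equiv {C : Type*} [Category* C] {Ω Ω' : C ⥤ FintypeCat}
    (e : ∀ x, Ω.obj x ≃ Ω'.obj x)
    (he : ∀ ⦃x y : C⦄ (f : x ⟶ y) (a : Ω.obj x), e y (Ω.map f a) = Ω'.map f (e x a))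
    (h : _root_.Indecomposable Ω) : _root_.Indecomposable Ω' := by
  obtain ⟨⟨x, ⟨a⟩⟩, h⟩ := h
  refine ⟨⟨x, ⟨e x a⟩⟩, fun S T hS hT hd hc => ?_⟩
  have preimage_eq_empty (S : ∀ x : C, Set (Ω'.obj x)) (hS : ∀ x, e x ⁻¹' S x = ∅) :
      ∀ x, S x = ∅ := fun x => by
    rw [← Set.image_preimage_eq (S x) (e x).surjective, hS, Set.image_empty]
  refine (h (fun x => e x ⁻¹' S x) (fun x => e x ⁻¹' T x) ?_ ?_ ?_ ?_).imp
    (preimage_eq_empty S) (preimage_eq_empty T)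
  · intro x y f a ha
    simpa only [Set.mem_preimage, he] using hS f _ ha
  · intro x y f a ha
    simpa only [Set.mem_preimage, he] using hT f _ ha
  · intro x
    rw [← Set.preimage_inter, hd, Set.preimage_empty]
  · intro x
    rw [← Set.preimage_union, hc, Set.preimage_univ]

/-- Every `C`-set can be transported to any universe along a natural family of bijections. -/
theorem exists_natural_equiv_universe.{w', w, v', u'} {C : Type u'} [Category.{v'} C]
    (Ω : C ⥤ FintypeCat.{w}) :
    ∃ (Ω' : C ⥤ FintypeCat.{w'}) (e : ∀ x, Ω.obj x ≃ Ω'.obj x),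
      ∀ ⦃x y : C⦄ (f : x ⟶ y) (a : Ω.obj x), e y (Ω.map f a) = Ω'.map f (e x a) := by
  let e (x : C) : Ω.obj x ≃ ULift.{w'} (Fin (Nat.card (Ω.obj x))) :=
    (Finite.equivFin _).trans Equiv.ulift.symm
  refine ⟨{ obj := fun x => FintypeCat.of (ULift.{w'} (Fin (Nat.card (Ω.obj x))))
            map := fun {x y} f => FintypeCat.homMk fun a => e y (Ω.map f ((e x).symm a))
            map_id := fun x => ?_
            map_comp := fun f g => ?_ }, e, fun x y f a => ?_⟩
  · refine FintypeCat.hom_ext _ _ fun a => ?_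
    change e x (Ω.map (𝟙 x) ((e x).symm a)) = a
    simp
  · refine FintypeCat.hom_ext _ _ fun a => ?_
    change e _ (Ω.map (f ≫ g) _) = e _ (Ω.map g ((e _).symm (e _ (Ω.map f _))))
    simp
  · change e y (Ω.map f a) = e y (Ω.map f ((e x).symm (e x a)))
    simp

/-- The element `a` of the `C`-set `Ω` generates `Ω`: every element is the image of `a`
under some morphism. -/
def Generates {C : Type*} [Category* C] (Ω : C ⥤ FintypeCat) (c : C) (a : Ω.obj c) : Prop :=
  ∀ (d : C), Function.Surjective fun f : c ⟶ d => Ω.map f a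

theorem SimpleCSet.exists_generates {C : Type*} [Category* C] {Ω : C ⥤ FintypeCat}
    (h : SimpleCSet Ω) : ∃ c a, Generates Ω c a := by
  obtain ⟨⟨c, ⟨a⟩⟩, h⟩ := h
  refine ⟨c, a, fun d => ?_⟩
  have hS : IsSubfunctor Ω fun d => Set.range fun f : c ⟶ d => Ω.map f a := by
    rintro x y f _ ⟨g, rfl⟩
    exact ⟨g ≫ f, by simp⟩
  rcases h _ hS with h | h
  · exact absurd (h c) (Set.Nonempty.ne_empty ⟨_, 𝟙 c, rfl⟩)
  · exact Set.range_eq_univ.mp (h d)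

/-- Two `C`-sets generated by elements at the same object satisfying the same relations are
isomorphic. -/
theorem Generates.nonempty_iso {C : Type*} [Category* C] {Ω Ω' : C ⥤ FintypeCat} {c : C}
    {a : Ω.obj c} {a' : Ω'.obj c} (ha : Generates Ω c a) (ha' : Generates Ω' c a')
    (h : ∀ (d : C) (f g : c ⟶ d), Ω.map f a = Ω.map g a ↔ Ω'.map f a' = Ω'.map g a') :
    Nonempty (Ω ≅ Ω') := by
  let φ (d : C) (y : Ω.obj d) : Ω'.obj d := Ω'.map (Function.surjInv (ha d) y) a'
  have hφ (d : C) (f : c ⟶ d) : φ d (Ω.map f a) = Ω'.map f a' :=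
    (h d _ _).mp (Function.surjInv_eq (ha d) _)
  have hbij (d : C) : Function.Bijective (φ d) := by
    constructor
    · intro y z hyz
      obtain ⟨f, rfl⟩ := ha d y
      obtain ⟨g, rfl⟩ := ha d z
      simpa only [hφ, h] using hyz
    · intro y
      obtain ⟨f, rfl⟩ := ha' d y
      exact ⟨_, hφ d f⟩
  refine ⟨NatIso.ofComponents
    (fun d => FintypeCat.equivEquivIso (Equiv.ofBijective (φ d) (hbij d))) ?_⟩
  intro x y f
  ext b
  obtain ⟨g, rfl⟩ := ha x b
  have := hφ y (g ≫ f)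
  simp only [Functor.map_comp, FintypeCat.comp_apply] at this
  simp [this, hφ]

/-- If every indecomposable `C`-set over a finite category `C` is simple, then `C` is of
finite type: there are finitely many indecomposable `C`-sets up to isomorphism. -/
theorem finiteType_of_semisimple {C : Type u} [SmallCategory C] [FinCategory C]
    (h : ∀ Ω : C ⥤ FintypeCat, Indecomposable Ω → SimpleCSet Ω) :
    ∃ (n : ℕ) (Ψ : Fin n → C ⥤ FintypeCat),
      ∀ Ω : C ⥤ FintypeCat, Indecomposable Ω → ∃ i, Nonempty (Ω ≅ Ψ i) := by
  have generated (Ω : C ⥤ FintypeCat) (hΩ : Indecomposable Ω) : ∃ c a, Generates Ω c a := by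
    obtain ⟨Ω', e, he⟩ := exists_natural_equiv_universe Ω
    obtain ⟨c, a, ha⟩ := (h Ω' (hΩ.of_equiv e he)).exists_generates
    refine ⟨c, (e c).symm a, fun d y => ?_⟩
    obtain ⟨f, hf⟩ := ha d (e d y)
    exact ⟨f, (e d).injective (by simpa [he] using hf)⟩
  let Relations := Σ c : C, ∀ d : C, (c ⟶ d) → (c ⟶ d) → Prop
  let Presents (r : Relations) (Ω : C ⥤ FintypeCat) : Prop :=
    ∃ a, Generates Ω r.1 a ∧ ∀ d f g, r.2 d f g ↔ Ω.map f a = Ω.map g a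
  have : Finite {r : Relations // ∃ Ω, Presents r Ω} := inferInstance
  obtain ⟨n, ⟨e⟩⟩ := Finite.exists_equiv_fin {r : Relations // ∃ Ω, Presents r Ω}
  refine ⟨n, fun i => (e.symm i).2.choose, fun Ω hΩ => ?_⟩
  obtain ⟨c, a, ha⟩ := generated Ω hΩ
  let r : {r : Relations // ∃ Ω, Presents r Ω} :=
    ⟨⟨c, fun d f g => Ω.map f a = Ω.map g a⟩, Ω, a, ha, fun _ _ _ => Iff.rfl⟩
  refine ⟨e r, ?_⟩
  simp only [e.symm_apply_apply]
  obtain ⟨a', ha', hr⟩ := r.2.choose_spec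
  exact ha.nonempty_iso ha' hr
end

section
/- Let C be a finite connected category. If C is of finite type, i.e. there exist finitely many C-sets Ψ₁, …, Ψₙ such that every indecomposable C-set is isomorphic to some Ψᵢ, then every morphism of C is an isomorphism (C is a groupoid). -/
open CategoryTheory

universe v u

section Glue

universe w

variable {C : Type u} [Category.{v} C] {x y : C}

/-- The elements over `z` of the C-set obtained from `N + 1` copies of `Hom(x, -)` by
identifying them along the subfunctor of morphisms factoring through `f : x ⟶ y`. Elements of
the common part are represented in the copy of index `0`. -/
def Glued (f : x ⟶ y) (N : ℕ) (z : C) : Type v :=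
  {p : Fin (N + 1) × (x ⟶ z) // (∃ h, f ≫ h = p.2) → p.1 = 0}

namespace Glued

instance [∀ a b : C, Finite (a ⟶ b)] (f : x ⟶ y) (N : ℕ) (z : C) : Finite (Glued f N z) :=
  inferInstanceAs (Finite {p : Fin (N + 1) × (x ⟶ z) // (∃ h, f ≫ h = p.2) → p.1 = 0})

open Classical in
/-- The class of the morphism `g` of the `i`-th copy of `Hom(x, -)`. -/
noncomputable def mk (f : x ⟶ y) {N : ℕ} (i : Fin (N + 1)) {z : C} (g : x ⟶ z) : Glued f N z :=
  ⟨(if ∃ h, f ≫ h = g then 0 else i, g), fun h => if_pos h⟩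

/-- The action of morphisms on glued elements. -/
noncomputable def map (f : x ⟶ y) (N : ℕ) {z z' : C} (k : z ⟶ z') (p : Glued f N z) :
    Glued f N z' :=
  mk f p.1.1 (p.1.2 ≫ k)

lemma mk_eta {f : x ⟶ y} {N : ℕ} {z : C} (p : Glued f N z) :
    mk f p.1.1 p.1.2 = p := by
  obtain ⟨⟨i, g⟩, hp⟩ := p
  by_cases h : ∃ h, f ≫ h = g
  · obtain rfl : i = 0 := hp h
    exact Subtype.ext (by simp [mk])
  · exact Subtype.ext (by simp [mk, h])

lemma map_mk (f : x ⟶ y) {N : ℕ} (i : Fin (N + 1)) {z z' : C} (g : x ⟶ z) (k : z ⟶ z') :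
    map f N k (mk f i g) = mk f i (g ≫ k) := by
  by_cases h : ∃ h, f ≫ h = g
  · have h' : ∃ h, f ≫ h = g ≫ k := by
      obtain ⟨h, rfl⟩ := h
      exact ⟨h ≫ k, by simp⟩
    exact Subtype.ext (by simp [map, mk, h'])
  · simp only [map, mk, if_neg h]
    rfl

lemma map_id (f : x ⟶ y) (N : ℕ) {z : C} (p : Glued f N z) : map f N (𝟙 z) p = p := by
  rw [← mk_eta p, map_mk, Category.comp_id]

lemma map_comp (f : x ⟶ y) (N : ℕ) {z z' z'' : C} (k : z ⟶ z') (k' : z' ⟶ z'')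
    (p : Glued f N z) : map f N (k ≫ k') p = map f N k' (map f N k p) := by
  rw [← mk_eta p, map_mk, map_mk, map_mk, Category.assoc]

lemma mk_self (f : x ⟶ y) {N : ℕ} (i j : Fin (N + 1)) : mk f i f = mk f j f := by
  have h : ∃ h, f ≫ h = f := ⟨𝟙 y, Category.comp_id f⟩
  exact Subtype.ext (by simp [mk, h])

lemma mk_id_injective {f : x ⟶ y} (hf : ¬ IsSplitMono f) (N : ℕ) :
    Function.Injective fun i : Fin (N + 1) => mk f i (𝟙 x) := by
  intro i j hij
  have h : ¬ ∃ h, f ≫ h = 𝟙 x := fun ⟨h, hh⟩ => hf (IsSplitMono.mk' ⟨h, hh⟩)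
  simpa [mk, h] using congrArg (fun p => p.1.1) hij

variable [∀ a b : C, Finite (a ⟶ b)]

/-- The C-set of glued elements, with values in an arbitrary universe. -/
noncomputable def functor (f : x ⟶ y) (N : ℕ) : C ⥤ FintypeCat.{w} where
  obj z := FintypeCat.of (Shrink.{w} (Glued f N z))
  map k := FintypeCat.homMk fun p => equivShrink.{w} _ (map f N k ((equivShrink.{w} _).symm p))
  map_id z := FintypeCat.hom_ext _ _ fun p => by
    change equivShrink.{w} _ (map f N (𝟙 z) ((equivShrink.{w} _).symm p)) = p
    rw [map_id, Equiv.apply_symm_apply]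
  map_comp k k' := FintypeCat.hom_ext _ _ fun p => by
    change equivShrink.{w} _ (map f N (k ≫ k') ((equivShrink.{w} _).symm p)) =
      equivShrink.{w} _ (map f N k' ((equivShrink.{w} _).symm
        (equivShrink.{w} _ (map f N k ((equivShrink.{w} _).symm p)))))
    rw [map_comp, Equiv.symm_apply_apply]

/-- The class of the morphism `g` of the `i`-th copy, as an element of `Glued.functor f N`. -/
noncomputable def elem (f : x ⟶ y) {N : ℕ} (i : Fin (N + 1)) {z : C} (g : x ⟶ z) :
    (functor.{v, u, w} f N).obj z :=
  equivShrink.{w} _ (mk f i g)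

lemma exists_elem_eq {f : x ⟶ y} {N : ℕ} {z : C} (p : (functor.{v, u, w} f N).obj z) :
    ∃ (i : Fin (N + 1)) (g : x ⟶ z), elem f i g = p := by
  obtain ⟨q, rfl⟩ := (equivShrink.{w} (Glued f N z)).surjective p
  exact ⟨q.1.1, q.1.2, congrArg (equivShrink.{w} _) (mk_eta q)⟩

lemma functor_map_elem (f : x ⟶ y) {N : ℕ} (i : Fin (N + 1)) {z z' : C} (g : x ⟶ z)
    (k : z ⟶ z') : (functor.{v, u, w} f N).map k (elem f i g) = elem f i (g ≫ k) := by
  change equivShrink.{w} _ (map f N k ((equivShrink.{w} _).symm (equivShrink.{w} _ (mk f i g)))) = _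
  rw [Equiv.symm_apply_apply, map_mk, elem]

lemma elem_mem_of_elem_id_mem {f : x ⟶ y} {N : ℕ} {S : ∀ z, Set ((functor.{v, u, w} f N).obj z)}
    (hS : IsSubfunctor _ S) {i : Fin (N + 1)} (hi : elem f i (𝟙 x) ∈ S x) {z : C} (g : x ⟶ z) :
    elem f i g ∈ S z := by
  simpa [functor_map_elem] using hS g _ hi

lemma eq_empty_of_elem_id_mem {f : x ⟶ y} {N : ℕ} {S T : ∀ z, Set ((functor.{v, u, w} f N).obj z)}
    (hS : IsSubfunctor _ S) (hT : IsSubfunctor _ T) (hST : ∀ z, S z ∩ T z = ∅)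
    (hST' : ∀ z, S z ∪ T z = Set.univ) {i : Fin (N + 1)} (hi : elem f i (𝟙 x) ∈ S x) (z : C) :
    T z = ∅ := by
  have disj {z : C} {p : (functor.{v, u, w} f N).obj z} (h : p ∈ S z) : p ∉ T z := fun h' =>
    (hST z).subset ⟨h, h'⟩
  refine Set.eq_empty_of_forall_notMem fun p => ?_
  obtain ⟨j, g, rfl⟩ := exists_elem_eq p
  refine disj (elem_mem_of_elem_id_mem hS ?_ g)
  refine ((hST' x).symm.subset (Set.mem_univ _)).resolve_right fun hj => ?_
  have hji : elem.{v, u, w} f j f = elem f i f := congrArg (equivShrink.{w} _) (mk_self f j i)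
  exact disj (elem_mem_of_elem_id_mem hS hi f) (hji ▸ elem_mem_of_elem_id_mem hT hj f)

lemma indecomposable_functor (f : x ⟶ y) (N : ℕ) : Indecomposable (functor.{v, u, w} f N) := by
  refine ⟨⟨x, ⟨elem f 0 (𝟙 x)⟩⟩, fun S T hS hT hST hST' => ?_⟩
  rcases (hST' x).symm.subset (Set.mem_univ (elem f 0 (𝟙 x))) with h | h
  · exact .inr (eq_empty_of_elem_id_mem hS hT hST hST' h)
  · exact .inl (eq_empty_of_elem_id_mem hT hS (fun z => Set.inter_comm _ _ ▸ hST z)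
      (fun z => Set.union_comm _ _ ▸ hST' z) h)

lemma lt_card_functor_obj {f : x ⟶ y} (hf : ¬ IsSplitMono f) (N : ℕ) :
    N < Nat.card ((functor.{v, u, w} f N).obj x) := by
  have := Nat.card_le_card_of_injective (fun i : Fin (N + 1) => elem.{v, u, w} f i (𝟙 x))
    ((equivShrink.{w} _).injective.comp (mk_id_injective hf N))
  rwa [Nat.card_fin] at this

end Glued

/-- In a category with finite hom-sets and finitely many indecomposable C-sets up to
isomorphism, every morphism is a split monomorphism. -/
lemma isSplitMono_of_finiteType [∀ a b : C, Finite (a ⟶ b)] {n : ℕ}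
    (Ψ : Fin n → C ⥤ FintypeCat.{w})
    (hΨ : ∀ Ω : C ⥤ FintypeCat.{w}, Indecomposable Ω → ∃ i, Nonempty (Ω ≅ Ψ i))
    (f : x ⟶ y) : IsSplitMono f := by
  by_contra hf
  obtain ⟨i, ⟨e⟩⟩ := hΨ _ (Glued.indecomposable_functor f (∑ i, Nat.card ((Ψ i).obj x)))
  have hcard := Nat.card_congr (FintypeCat.equivEquivIso.symm (e.app x))
  have hle : Nat.card ((Ψ i).obj x) ≤ ∑ i, Nat.card ((Ψ i).obj x) :=
    Finset.single_le_sum (f := fun i => Nat.card ((Ψ i).obj x)) (fun _ _ => Nat.zero_le _)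
      (Finset.mem_univ i)
  exact absurd (hcard ▸ Glued.lt_card_functor_obj hf _) hle.not_gt

end Glue

/-- A finite connected category of finite type (finitely many indecomposable `C`-sets
up to isomorphism) is a groupoid: every morphism is an isomorphism. -/
theorem groupoid_of_finiteType {C : Type u} [SmallCategory C] [FinCategory C]
    [IsConnected C]
    (h : ∃ (n : ℕ) (Ψ : Fin n → C ⥤ FintypeCat),
      ∀ Ω : C ⥤ FintypeCat, Indecomposable Ω → ∃ i, Nonempty (Ω ≅ Ψ i)) :
    ∀ ⦃x y : C⦄ (f : x ⟶ y), IsIso f := by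
  intro x y f
  obtain ⟨n, Ψ, hΨ⟩ := h
  have := isSplitMono_of_finiteType Ψ hΨ f
  have := isSplitMono_of_finiteType Ψ hΨ (retraction f)
  have : IsIso (retraction f) := isIso_of_mono_of_isSplitEpi _
  exact IsIso.of_isIso_fac_right (IsSplitMono.id f)
end

section
/- Let C be a category such that for every C-set Ω, all objects x, y and all a ∈ Ω(x), b ∈ Ω(y), whenever (x,a) and (y,b) are connected by a zigzag in the category of elements of Ω there exists a morphism f : x ⟶ y with Ω(f)(a) = b. Then every indecomposable C-set is simple. -/
open CategoryTheory

universe v u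

universe w₁ w₂

section Transport

variable {C : Type u} [Category.{v} C]

/-- A finite type in any universe is equivalent to a finite type in any other universe. -/
noncomputable def finiteEquivULiftFin (X : Type w₁) [Finite X] :
    X ≃ ULift.{w₂} (Fin (Nat.card X)) :=
  (Finite.equivFin X).trans Equiv.ulift.symm

/-- A copy of a `C`-set with values in another universe. -/
noncomputable def transportUniverse (Ω : C ⥤ FintypeCat.{w₁}) : C ⥤ FintypeCat.{w₂} where
  obj x := FintypeCat.of (ULift.{w₂} (Fin (Nat.card (Ω.obj x))))
  map f := FintypeCat.homMk fun a =>
    finiteEquivULiftFin.{w₁, w₂} _ (Ω.map f ((finiteEquivULiftFin.{w₁, w₂} _).symm a))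
  map_id x := by
    refine FintypeCat.hom_ext _ _ fun a => ?_
    change finiteEquivULiftFin.{w₁, w₂} _ (Ω.map (𝟙 x) ((finiteEquivULiftFin.{w₁, w₂} _).symm a)) = a
    simp
  map_comp {x y z} f g := by
    refine FintypeCat.hom_ext _ _ fun a => ?_
    change finiteEquivULiftFin.{w₁, w₂} _ (Ω.map (f ≫ g) ((finiteEquivULiftFin.{w₁, w₂} _).symm a)) =
      finiteEquivULiftFin.{w₁, w₂} _ (Ω.map g ((finiteEquivULiftFin.{w₁, w₂} _).symm
        (finiteEquivULiftFin.{w₁, w₂} _ (Ω.map f ((finiteEquivULiftFin.{w₁, w₂} _).symm a)))))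
    simp

theorem transportUniverse_map_apply (Ω : C ⥤ FintypeCat.{w₁}) {x y : C} (f : x ⟶ y)
    (a : Ω.obj x) :
    (transportUniverse.{v, u, w₁, w₂} Ω).map f (finiteEquivULiftFin.{w₁, w₂} (Ω.obj x) a) =
      finiteEquivULiftFin.{w₁, w₂} (Ω.obj y) (Ω.map f a) := by
  change finiteEquivULiftFin.{w₁, w₂} _ (Ω.map f ((finiteEquivULiftFin.{w₁, w₂} _).symm
    (finiteEquivULiftFin.{w₁, w₂} _ a))) = _
  rw [Equiv.symm_apply_apply]

/-- If zigzag-connected elements of `C`-sets are related by a morphism, then every morphism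
acts reversibly on each element of a `C`-set, in any universe. -/
theorem exists_map_map_eq
    (h : ∀ (Ω : C ⥤ FintypeCat.{w₂}) (x y : C) (a : Ω.obj x) (b : Ω.obj y),
      WalkConnected Ω ⟨x, a⟩ ⟨y, b⟩ → ∃ f : x ⟶ y, Ω.map f a = b)
    (Ω : C ⥤ FintypeCat.{w₁}) {x y : C} (f : x ⟶ y) (a : Ω.obj x) :
    ∃ g : y ⟶ x, Ω.map g (Ω.map f a) = a := by
  obtain ⟨g, hg⟩ := h (transportUniverse.{v, u, w₁, w₂} Ω) y x
    (finiteEquivULiftFin.{w₁, w₂} (Ω.obj y) (Ω.map f a))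
    (finiteEquivULiftFin.{w₁, w₂} (Ω.obj x) a)
    (Relation.ReflTransGen.single (Or.inr ⟨f, transportUniverse_map_apply Ω f a⟩))
  exact ⟨g, (finiteEquivULiftFin.{w₁, w₂} _).injective
    ((transportUniverse_map_apply Ω g (Ω.map f a)).symm.trans hg)⟩

end Transport

/-- If in a category `C` any two zigzag-connected elements of any `C`-set are related by
the action of a single morphism, then every indecomposable `C`-set is simple. -/
theorem semisimple_of_walk_action {C : Type u} [Category.{v} C]
    (h : ∀ (Ω : C ⥤ FintypeCat) (x y : C) (a : Ω.obj x) (b : Ω.obj y),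
      WalkConnected Ω ⟨x, a⟩ ⟨y, b⟩ → ∃ f : x ⟶ y, Ω.map f a = b) :
    ∀ Ω : C ⥤ FintypeCat, Indecomposable Ω → SimpleCSet Ω := by
  rintro Ω ⟨hne, hind⟩
  refine ⟨hne, fun S hS => ?_⟩
  have hSc : IsSubfunctor Ω fun x => (S x)ᶜ := fun x y f a ha hfa => by
    obtain ⟨g, hg⟩ := exists_map_map_eq h Ω f a
    exact ha (hg ▸ hS g _ hfa)
  exact (hind S (fun x => (S x)ᶜ) hS hSc (fun x => Set.inter_compl_self _)
    fun x => Set.union_compl_self _).imp_right fun hT x => Set.compl_empty_iff.1 (hT x)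
end

section
/- Let C be a finite connected category. Then C is of finite type (there exist finitely many C-sets Ψ₁, …, Ψₙ such that every indecomposable C-set is isomorphic to some Ψᵢ) if and only if every morphism of C is an isomorphism. -/
open CategoryTheory

universe v u

universe w

section Representable

variable {C : Type u} [Category.{v} C]

/-- If every morphism is a split monomorphism, then every morphism is an isomorphism. -/
theorem isIso_of_forall_isSplitMono (h : ∀ ⦃x y : C⦄ (f : x ⟶ y), IsSplitMono f)
    {x y : C} (f : x ⟶ y) : IsIso f := by
  have := h f
  have := h (retraction f)
  have : IsIso (retraction f) := isIso_of_mono_of_isSplitEpi _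
  have : IsIso (f ≫ retraction f) := by rw [IsSplitMono.id f]; infer_instance
  exact IsIso.of_isIso_comp_right f (retraction f)

/-- The values of `n + 1` copies of the representable functor at `x`, glued along the
morphisms that are not split monomorphisms. -/
def GluedHom (x : C) (n : ℕ) (z : C) : Type v :=
  {p : (x ⟶ z) × Fin (n + 1) // ¬ IsSplitMono p.1 → p.2 = 0}

instance (x : C) (n : ℕ) (z : C) [Finite (x ⟶ z)] : Finite (GluedHom x n z) :=
  inferInstanceAs (Finite {p : (x ⟶ z) × Fin (n + 1) // ¬ IsSplitMono p.1 → p.2 = 0})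

namespace GluedHom

open Classical in
/-- The class of a morphism in the `i`-th copy. -/
noncomputable def mk {x : C} {n : ℕ} {z : C} (g : x ⟶ z) (i : Fin (n + 1)) : GluedHom x n z :=
  ⟨(g, if IsSplitMono g then i else 0), fun h => if_neg h⟩

theorem mk_surjective {x : C} {n : ℕ} {z : C} (p : GluedHom x n z) :
    ∃ g i, mk g i = p := by
  obtain ⟨⟨g, i⟩, h⟩ := p
  refine ⟨g, i, Subtype.ext (Prod.ext rfl ?_)⟩
  by_cases hg : IsSplitMono g
  · exact if_pos hg
  · exact (if_neg hg).trans (h hg).symm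

theorem mk_eq_mk_of_not_isSplitMono {x : C} {n : ℕ} {z : C} {g : x ⟶ z}
    (hg : ¬ IsSplitMono g) (i j : Fin (n + 1)) : mk g i = mk g j :=
  Subtype.ext (Prod.ext rfl ((if_neg hg).trans (if_neg hg).symm))

theorem mk_id_injective (x : C) (n : ℕ) :
    Function.Injective (mk (𝟙 x) : Fin (n + 1) → GluedHom x n x) := by
  intro i j h
  simpa [mk, show IsSplitMono (𝟙 x) from inferInstance] using
    congrArg (fun p : GluedHom x n x => p.1.2) h

/-- The action of a morphism by postcomposition. -/
noncomputable def map {x : C} {n : ℕ} {y z : C} (h : y ⟶ z) (p : GluedHom x n y) :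
    GluedHom x n z :=
  mk (p.1.1 ≫ h) p.1.2

theorem map_mk {x : C} {n : ℕ} {y z : C} (h : y ⟶ z) (g : x ⟶ y) (i : Fin (n + 1)) :
    map h (mk g i) = mk (g ≫ h) i := by
  by_cases hg : IsSplitMono g
  · exact congrArg (mk (g ≫ h)) (if_pos hg)
  · refine mk_eq_mk_of_not_isSplitMono (fun (hgh : IsSplitMono (g ≫ h)) => hg ?_) _ _
    exact IsSplitMono.mk' ⟨h ≫ retraction (g ≫ h), by
      rw [← Category.assoc]; exact IsSplitMono.id (g ≫ h)⟩

end GluedHom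

/-- Finitely many copies of a representable functor, glued along the morphisms that are not
split monomorphisms, as a `C`-set. -/
noncomputable def gluedRepresentable [∀ y z : C, Finite (y ⟶ z)] (x : C) (n : ℕ) :
    C ⥤ FintypeCat.{w} where
  obj z := FintypeCat.of (Shrink.{w} (GluedHom x n z))
  map {y z} h := FintypeCat.homMk fun p : Shrink.{w} (GluedHom x n y) =>
    equivShrink.{w} (GluedHom x n z) (GluedHom.map h ((equivShrink.{w} _).symm p))
  map_id z := by
    refine FintypeCat.hom_ext _ _ fun p => ?_
    obtain ⟨p, rfl⟩ := (equivShrink.{w} (GluedHom x n z)).surjective p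
    obtain ⟨g, i, rfl⟩ := p.mk_surjective
    rw [FintypeCat.homMk_apply, Equiv.symm_apply_apply, GluedHom.map_mk, Category.comp_id]
    rfl
  map_comp {y _ _} h k := by
    refine FintypeCat.hom_ext _ _ fun p => ?_
    obtain ⟨p, rfl⟩ := (equivShrink.{w} (GluedHom x n y)).surjective p
    obtain ⟨g, i, rfl⟩ := p.mk_surjective
    rw [FintypeCat.comp_apply]
    rw [FintypeCat.homMk_apply, FintypeCat.homMk_apply, FintypeCat.homMk_apply]
    simp only [Equiv.symm_apply_apply, GluedHom.map_mk, Category.assoc]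

namespace gluedRepresentable

variable [∀ y z : C, Finite (y ⟶ z)]

/-- The element of the glued representable functor given by a morphism in the `i`-th copy. -/
noncomputable def mk {x : C} {n : ℕ} {z : C} (g : x ⟶ z) (i : Fin (n + 1)) :
    (gluedRepresentable x n : C ⥤ FintypeCat.{w}).obj z :=
  equivShrink.{w} (GluedHom x n z) (GluedHom.mk g i)

theorem mk_surjective {x : C} {n : ℕ} {z : C}
    (p : (gluedRepresentable x n : C ⥤ FintypeCat.{w}).obj z) : ∃ g i, mk g i = p := by
  obtain ⟨q, rfl⟩ := (equivShrink.{w} (GluedHom x n z)).surjective p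
  obtain ⟨g, i, rfl⟩ := q.mk_surjective
  exact ⟨g, i, rfl⟩

theorem map_mk {x : C} {n : ℕ} {y z : C} (h : y ⟶ z) (g : x ⟶ y) (i : Fin (n + 1)) :
    (gluedRepresentable x n : C ⥤ FintypeCat.{w}).map h (mk g i) = mk (g ≫ h) i := by
  refine (FintypeCat.homMk_apply _ _).trans ?_
  rw [mk, Equiv.symm_apply_apply, GluedHom.map_mk, mk]

theorem map_mk_id {x : C} {n : ℕ} {z : C} (g : x ⟶ z) (i : Fin (n + 1)) :
    (gluedRepresentable x n : C ⥤ FintypeCat.{w}).map g (mk (𝟙 x) i) = mk g i := by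
  rw [map_mk, Category.id_comp]

theorem indecomposable {x z : C} (g : x ⟶ z) (hg : ¬ IsSplitMono g) (n : ℕ) :
    Indecomposable (gluedRepresentable x n : C ⥤ FintypeCat.{w}) := by
  refine ⟨⟨x, ⟨mk (𝟙 x) 0⟩⟩, ?_⟩
  have key : ∀ S T : ∀ y : C, Set ((gluedRepresentable x n : C ⥤ FintypeCat.{w}).obj y),
      IsSubfunctor _ S → IsSubfunctor _ T →
      (∀ y, S y ∩ T y = ∅) → (∀ y, S y ∪ T y = Set.univ) → mk g 0 ∈ S z → ∀ y, T y = ∅ := by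
    intro S T hS hT hd hc hgS y
    have hid (i) : mk (𝟙 x) i ∈ S x := by
      refine ((Set.eq_univ_iff_forall.1 (hc x)) (mk (𝟙 x) i)).resolve_right fun hi => ?_
      have hgT := hT g _ hi
      rw [map_mk_id, show mk g i = mk g 0 from
        congrArg (equivShrink.{w} _) (GluedHom.mk_eq_mk_of_not_isSplitMono hg i 0)] at hgT
      exact Set.eq_empty_iff_forall_notMem.1 (hd z) _ ⟨hgS, hgT⟩
    refine Set.eq_empty_iff_forall_notMem.2 fun p hp => ?_
    obtain ⟨h, i, rfl⟩ := mk_surjective p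
    have hhS := hS h _ (hid i)
    rw [map_mk_id] at hhS
    exact Set.eq_empty_iff_forall_notMem.1 (hd y) _ ⟨hhS, hp⟩
  intro S T hS hT hd hc
  rcases (Set.eq_univ_iff_forall.1 (hc z)) (mk g 0) with h | h
  · exact Or.inr (key S T hS hT hd hc h)
  · exact Or.inl (key T S hT hS (fun y => Set.inter_comm _ _ ▸ hd y)
      (fun y => Set.union_comm _ _ ▸ hc y) h)

theorem lt_card_obj (x : C) (n : ℕ) :
    n < Nat.card ((gluedRepresentable x n : C ⥤ FintypeCat.{w}).obj x) := by
  have hinj : Function.Injective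
      fun i => (mk (𝟙 x) i : (gluedRepresentable x n : C ⥤ FintypeCat.{w}).obj x) :=
    (equivShrink.{w} _).injective.comp (GluedHom.mk_id_injective x n)
  simpa using Nat.card_le_card_of_injective _ hinj

end gluedRepresentable

end Representable

section Bounded

variable {C : Type u} [Category.{v} C]

/-- An indecomposable `C`-set over a groupoid is generated by each of its elements. -/
theorem Indecomposable.map_surjective {Ω : C ⥤ FintypeCat.{w}} (hΩ : Indecomposable Ω)
    (hC : ∀ ⦃x y : C⦄ (f : x ⟶ y), IsIso f) {x : C} (p : Ω.obj x) (y : C) :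
    Function.Surjective fun f : x ⟶ y => Ω.map f p := by
  have h := hΩ.2 (fun y => Set.range fun f : x ⟶ y => Ω.map f p)
    (fun y => (Set.range fun f : x ⟶ y => Ω.map f p)ᶜ) ?_ ?_
    (fun y => Set.inter_compl_self _) (fun y => Set.union_compl_self _)
  · rcases h with h | h
    · exact absurd (h x ▸ Set.mem_range_self (𝟙 x) : Ω.map (𝟙 x) p ∈ (∅ : Set _)) id
    · exact Set.range_eq_univ.1 (Set.compl_empty_iff.1 (h y))
  · rintro a b f _ ⟨g, rfl⟩
    exact ⟨g ≫ f, by simp⟩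
  · rintro a b f q hq ⟨g, hg⟩
    have := hC f
    refine hq ⟨g ≫ inv f, ?_⟩
    simp only at hg
    simp only [Functor.map_comp, FintypeCat.comp_apply, hg]
    rw [← FintypeCat.comp_apply, ← Functor.map_comp, IsIso.hom_inv_id]
    simp

/-- A family of maps between standard finite sets of size at most `N`, indexed by the morphisms
of `C`. -/
abbrev CSetTable (C : Type u) [Category.{v} C] (N : ℕ) : Type max u v :=
  Σ c : C → Fin (N + 1), ∀ a b : C, (a ⟶ b) → Fin (c a) → Fin (c b)

/-- The `C`-set `Ω` is described by the table `d` in suitable coordinates. -/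
def CSetTable.Describes {N : ℕ} (d : CSetTable C N) (Ω : C ⥤ FintypeCat.{w}) : Prop :=
  ∃ e : ∀ a, Ω.obj a ≃ Fin (d.1 a), ∀ (a b : C) (f : a ⟶ b) (p : Ω.obj a),
    e b (Ω.map f p) = d.2 a b f (e a p)

theorem CSetTable.exists_describes {N : ℕ} (Ω : C ⥤ FintypeCat.{w})
    (hN : ∀ a, Nat.card (Ω.obj a) ≤ N) : ∃ d : CSetTable C N, d.Describes Ω :=
  ⟨⟨fun a => ⟨Nat.card (Ω.obj a), Nat.lt_succ_of_le (hN a)⟩,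
      fun a b f i => Finite.equivFin (Ω.obj b) (Ω.map f ((Finite.equivFin (Ω.obj a)).symm i))⟩,
    fun a => Finite.equivFin (Ω.obj a), fun a b f p => by simp⟩

theorem CSetTable.Describes.nonempty_iso {N : ℕ} {d : CSetTable C N} {Ω Ω' : C ⥤ FintypeCat.{w}}
    (h : d.Describes Ω) (h' : d.Describes Ω') : Nonempty (Ω ≅ Ω') := by
  obtain ⟨e, he⟩ := h
  obtain ⟨e', he'⟩ := h'
  refine ⟨NatIso.ofComponents
    (fun a => FintypeCat.equivEquivIso ((e a).trans (e' a).symm)) fun {a b} f => ?_⟩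
  ext p
  apply (e' b).injective
  simp [he, he']

/-- Up to isomorphism there are finitely many `C`-sets with values of bounded size. -/
theorem exists_finite_representatives_of_card_le [Finite C] [∀ a b : C, Finite (a ⟶ b)] (N : ℕ) :
    ∃ (n : ℕ) (Ψ : Fin n → C ⥤ FintypeCat.{w}),
      ∀ Ω : C ⥤ FintypeCat.{w}, (∀ a, Nat.card (Ω.obj a) ≤ N) → ∃ i, Nonempty (Ω ≅ Ψ i) := by
  obtain ⟨n, ⟨e⟩⟩ := Finite.exists_equiv_fin
    {d : CSetTable C N // ∃ Ω : C ⥤ FintypeCat.{w}, d.Describes Ω}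
  refine ⟨n, fun i => (e.symm i).2.choose, fun Ω hΩ => ?_⟩
  obtain ⟨d, hd⟩ := CSetTable.exists_describes Ω hΩ
  have hd' : ∃ Ω : C ⥤ FintypeCat.{w}, d.Describes Ω := ⟨Ω, hd⟩
  refine ⟨e ⟨d, hd'⟩, ?_⟩
  simp only [Equiv.symm_apply_apply]
  exact hd.nonempty_iso hd'.choose_spec

end Bounded

/-- A finite connected category is of finite type (finitely many indecomposable
`C`-sets up to isomorphism) if and only if every morphism is an isomorphism. -/
theorem finiteType_iff_groupoid {C : Type u} [SmallCategory C] [FinCategory C]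
    [IsConnected C] :
    (∃ (n : ℕ) (Ψ : Fin n → C ⥤ FintypeCat),
        ∀ Ω : C ⥤ FintypeCat, Indecomposable Ω → ∃ i, Nonempty (Ω ≅ Ψ i)) ↔
      ∀ ⦃x y : C⦄ (f : x ⟶ y), IsIso f := by
  constructor
  · rintro ⟨n, Ψ, hΨ⟩
    refine fun _ _ f => isIso_of_forall_isSplitMono (fun x z g => ?_) f
    by_contra hg
    obtain ⟨i, ⟨e⟩⟩ := hΨ _ (gluedRepresentable.indecomposable g hg
      (∑ i, Nat.card ((Ψ i).obj x)))
    have hlt := gluedRepresentable.lt_card_obj x (∑ i, Nat.card ((Ψ i).obj x))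
    rw [Nat.card_congr (FintypeCat.equivEquivIso.symm (e.app x))] at hlt
    exact hlt.not_ge (Finset.single_le_sum (f := fun i => Nat.card ((Ψ i).obj x))
      (fun _ _ => Nat.zero_le _) (Finset.mem_univ i))
  · intro hC
    obtain ⟨n, Ψ, hΨ⟩ := exists_finite_representatives_of_card_le (C := C)
      (∑ q : C × C, Nat.card (q.1 ⟶ q.2))
    refine ⟨n, Ψ, fun Ω hΩ => hΨ Ω fun y => ?_⟩
    obtain ⟨x, ⟨p⟩⟩ := hΩ.1
    exact (Nat.card_le_card_of_surjective _ (hΩ.map_surjective hC p y)).trans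
      (Finset.single_le_sum (f := fun q : C × C => Nat.card (q.1 ⟶ q.2))
        (fun _ _ => Nat.zero_le _) (Finset.mem_univ (x, y)))
end

section
/- Let C be a finite connected category in which every morphism is an isomorphism (a finite connected groupoid). Then there exist finitely many C-sets Ψ₁, …, Ψₙ such that every indecomposable C-set is isomorphic to some Ψᵢ. -/
open CategoryTheory

universe v u

/-- The pairs of parallel morphisms out of `x` which act identically on `a`. -/
def coincidences {C : Type u} [Category.{v} C] (Ω : C ⥤ FintypeCat) {x : C} (a : Ω.obj x) :
    Set (Σ y : C, (x ⟶ y) × (x ⟶ y)) :=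
  {p | Ω.map p.2.1 a = Ω.map p.2.2 a}

/-- An indecomposable `C`-set over a groupoid is generated by any of its elements. -/
theorem Indecomposable.exists_map_eq {C : Type u} [Category.{v} C]
    (hgpd : ∀ ⦃x y : C⦄ (f : x ⟶ y), IsIso f) {Ω : C ⥤ FintypeCat} (hΩ : Indecomposable Ω)
    {x : C} (a : Ω.obj x) {y : C} (b : Ω.obj y) : ∃ f : x ⟶ y, Ω.map f a = b := by
  by_contra hb
  let S : ∀ y : C, Set (Ω.obj y) := fun y => {b | ∃ f : x ⟶ y, Ω.map f a = b}
  have hS : IsSubfunctor Ω S := by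
    rintro y z g _ ⟨f, rfl⟩
    exact ⟨f ≫ g, by simp⟩
  have hSc : IsSubfunctor Ω fun y => (S y)ᶜ := by
    rintro y z g c hc ⟨f, hf⟩
    have := hgpd g
    refine hc ⟨f ≫ inv g, ?_⟩
    rw [Functor.map_comp, FintypeCat.comp_apply, hf, ← FintypeCat.comp_apply,
      ← Functor.map_comp, IsIso.hom_inv_id, CategoryTheory.Functor.map_id,
      FintypeCat.id_apply]
  rcases hΩ.2 S (fun y => (S y)ᶜ) hS hSc (fun _ => Set.inter_compl_self _)
      (fun _ => Set.union_compl_self _) with h | h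
  · exact Set.eq_empty_iff_forall_notMem.1 (h x) a ⟨𝟙 x, by simp⟩
  · exact Set.eq_empty_iff_forall_notMem.1 (h y) b hb

/-- Two `C`-sets generated by elements over the same object with the same coincidences
are isomorphic. -/
theorem nonempty_iso_of_coincidences_eq {C : Type u} [Category.{v} C] {Ω Ω' : C ⥤ FintypeCat}
    {x : C} {a : Ω.obj x} {a' : Ω'.obj x}
    (ha : ∀ (y : C) (b : Ω.obj y), ∃ f : x ⟶ y, Ω.map f a = b)
    (ha' : ∀ (y : C) (b : Ω'.obj y), ∃ f : x ⟶ y, Ω'.map f a' = b)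
    (h : coincidences Ω a = coincidences Ω' a') : Nonempty (Ω ≅ Ω') := by
  have key {y : C} (f g : x ⟶ y) : Ω.map f a = Ω.map g a ↔ Ω'.map f a' = Ω'.map g a' :=
    Set.ext_iff.1 h ⟨y, f, g⟩
  choose φ hφ using ha
  choose φ' hφ' using ha'
  refine ⟨NatIso.ofComponents (fun y => FintypeCat.equivEquivIso
    { toFun := fun b => Ω'.map (φ y b) a'
      invFun := fun b => Ω.map (φ' y b) a
      left_inv := fun b => ?_
      right_inv := fun b => ?_ }) fun {y z} g => ?_⟩
  · exact ((key _ _).2 (hφ' y _)).trans (hφ y b)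
  · exact ((key _ _).1 (hφ y _)).trans (hφ' y b)
  · ext b
    change Ω'.map (φ z (Ω.map g b)) a' = Ω'.map g (Ω'.map (φ y b) a')
    rw [← FintypeCat.comp_apply, ← Functor.map_comp, ← key, hφ, Functor.map_comp,
      FintypeCat.comp_apply, hφ]

/-- A finite connected groupoid is of finite type: there are finitely many
indecomposable `C`-sets up to isomorphism. -/
theorem finiteType_of_groupoid {C : Type u} [SmallCategory C] [FinCategory C]
    [IsConnected C] (hgpd : ∀ ⦃x y : C⦄ (f : x ⟶ y), IsIso f) :
    ∃ (n : ℕ) (Ψ : Fin n → C ⥤ FintypeCat),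
      ∀ Ω : C ⥤ FintypeCat, Indecomposable Ω → ∃ i, Nonempty (Ω ≅ Ψ i) := by
  choose x hx using fun Ω : {Ω : C ⥤ FintypeCat // Indecomposable Ω} => Ω.2.1
  let a Ω := (hx Ω).some
  let code (Ω : {Ω : C ⥤ FintypeCat // Indecomposable Ω}) :
      Σ x : C, Set (Σ y : C, (x ⟶ y) × (x ⟶ y)) := ⟨x Ω, coincidences Ω.1 (a Ω)⟩
  obtain ⟨n, ⟨e⟩⟩ := Finite.exists_equiv_fin (Set.range code)
  choose Ψ hΨ using fun i => Set.mem_range.1 (e.symm i).2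
  refine ⟨n, fun i => (Ψ i).1, fun Ω hΩ => ⟨e ⟨code ⟨Ω, hΩ⟩, ⟨Ω, hΩ⟩, rfl⟩, ?_⟩⟩
  have hcode := hΨ (e ⟨code ⟨Ω, hΩ⟩, ⟨Ω, hΩ⟩, rfl⟩)
  rw [Equiv.symm_apply_apply] at hcode
  change Nonempty (Ω ≅ (Ψ _).1)
  generalize Ψ _ = Ω' at hcode ⊢
  have iso_of_code {p q : Σ x : C, Set (Σ y : C, (x ⟶ y) × (x ⟶ y))} (hpq : p = q)
      (b : Ω'.1.obj p.1) (c : Ω.obj q.1) (hb : coincidences Ω'.1 b = p.2)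
      (hc : coincidences Ω c = q.2) : Nonempty (Ω ≅ Ω'.1) := by
    subst hpq
    exact nonempty_iso_of_coincidences_eq (fun _ => hΩ.exists_map_eq hgpd c)
      (fun _ => Ω'.2.exists_map_eq hgpd b) (hc.trans hb.symm)
  exact iso_of_code hcode (a Ω') (a ⟨Ω, hΩ⟩) rfl rfl
end
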